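/- Let f, f̃ : [0,R) → [0,∞) both be C¹, convex, vanishing at 0, positive on (0,R), and assume their associated limits 𝔉 and 𝔉̃ both exist. If f = O(f̃) near zero, then 𝔉(σ) ≤ 𝔉̃(σ) for all σ ≥ 1, and consequently C_f ≤ C_{f̃}. -/

import Mathlib

open Set Filter Real Topology MeasureTheory

/-- `f` is a differentiable convex warping function on `[0, R)` with range `[0, L)`,
and `F` is its inverse, differentiable on `(0, L)`. -/
structure IsWarpingPair (R L : ℝ) (f f' F F' : ℝ → ℝ) : Prop where
  pos_left : 0 < R
  pos_right : 0 < L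
  hasDerivAt : ∀ r ∈ Ioo 0 R, HasDerivAt f (f' r) r
  convexOn : ConvexOn ℝ (Ico 0 R) f
  map_zero : f 0 = 0
  pos : ∀ r ∈ Ioo 0 R, 0 < f r
  hasDerivAt_inv : ∀ ρ ∈ Ioo 0 L, HasDerivAt F (F' ρ) ρ
  bijOn : BijOn f (Ico 0 R) (Ico 0 L)
  invOn : InvOn F f (Ico 0 R) (Ico 0 L)

/-- A convex function vanishing at `0` satisfies `f (t r) ≤ t f r` for `t ∈ [0, 1]`. -/
theorem ConvexOn.map_mul_le_mul_map {R : ℝ} {f : ℝ → ℝ} (hf : ConvexOn ℝ (Ico 0 R) f)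
    (hR : 0 < R) (h0 : f 0 = 0) {t r : ℝ} (ht : t ∈ Icc (0 : ℝ) 1) (hr : r ∈ Ico 0 R) :
    f (t * r) ≤ t * f r := by
  have := hf.2 hr (show (0 : ℝ) ∈ Ico 0 R from ⟨le_rfl, hR⟩) ht.1 (sub_nonneg.2 ht.2) (by ring)
  simpa [h0] using this

theorem eventually_mem_Ioo_nhdsGT_zero {L : ℝ} (hL : 0 < L) :
    ∀ᶠ ε in 𝓝[>] (0 : ℝ), ε ∈ Ioo 0 L :=
  Ioo_mem_nhdsGT hL

theorem tendsto_const_mul_nhdsGT_zero {σ : ℝ} (hσ : 0 < σ) :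
    Tendsto (fun ε : ℝ => σ * ε) (𝓝[>] 0) (𝓝[>] 0) := by
  refine tendsto_nhdsWithin_iff.2 ⟨?_, ?_⟩
  · have : Tendsto (fun ε : ℝ => σ * ε) (𝓝 0) (𝓝 (σ * 0)) := by
      exact (continuous_const_mul σ).tendsto 0
    rw [mul_zero] at this
    exact this.mono_left nhdsWithin_le_nhds
  · filter_upwards [self_mem_nhdsWithin] with ε hε
    exact mul_pos hσ hε

namespace IsWarpingPair

variable {R L : ℝ} {f f' F F' : ℝ → ℝ}

theorem strictMonoOn (h : IsWarpingPair R L f f' F F') : StrictMonoOn f (Ico 0 R) := by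
  intro r hr s hs hrs
  have hs0 : 0 < s := hr.1.trans_lt hrs
  have h1 := h.convexOn.map_mul_le_mul_map h.pos_left h.map_zero
    (t := r / s) ⟨div_nonneg hr.1 hs0.le, (div_le_one hs0).2 hrs.le⟩ hs
  rw [div_mul_cancel₀ _ hs0.ne'] at h1
  exact h1.trans_lt (mul_lt_of_lt_one_left (h.pos s ⟨hs0, hs.2⟩) ((div_lt_one hs0).2 hrs))

theorem mapsTo_inv (h : IsWarpingPair R L f f' F F') : MapsTo F (Ico 0 L) (Ico 0 R) := by
  intro ρ hρ
  obtain ⟨r, hr, rfl⟩ := h.bijOn.surjOn hρ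
  rwa [h.invOn.1 hr]

theorem strictMonoOn_inv (h : IsWarpingPair R L f f' F F') : StrictMonoOn F (Ico 0 L) := by
  intro ρ hρ τ hτ hlt
  refine (h.strictMonoOn.lt_iff_lt (h.mapsTo_inv hρ) (h.mapsTo_inv hτ)).1 ?_
  rwa [h.invOn.2 hρ, h.invOn.2 hτ]

theorem inv_zero (h : IsWarpingPair R L f f' F F') : F 0 = 0 := by
  have := h.invOn.1 (show (0 : ℝ) ∈ Ico 0 R from ⟨le_rfl, h.pos_left⟩)
  rwa [h.map_zero] at this

theorem mapsTo_inv_Ioo (h : IsWarpingPair R L f f' F F') : MapsTo F (Ioo 0 L) (Ioo 0 R) := by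
  intro ρ hρ
  refine ⟨?_, (h.mapsTo_inv ⟨hρ.1.le, hρ.2⟩).2⟩
  have := h.strictMonoOn_inv ⟨le_rfl, h.pos_right⟩ ⟨hρ.1.le, hρ.2⟩ hρ.1
  rwa [h.inv_zero] at this

theorem tendsto_inv (h : IsWarpingPair R L f f' F F') : Tendsto F (𝓝[>] 0) (𝓝[>] 0) := by
  refine ((nhdsGT_basis (0 : ℝ)).tendsto_right_iff).2 fun η hη => ?_
  obtain ⟨s, hs0, hs⟩ := exists_between (lt_min hη h.pos_left)
  have hsR : s ∈ Ioo 0 R := ⟨hs0, hs.trans_le (min_le_right _ _)⟩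
  have hsR' : s ∈ Ico 0 R := ⟨hs0.le, hsR.2⟩
  filter_upwards [eventually_mem_Ioo_nhdsGT_zero h.pos_right,
    eventually_mem_Ioo_nhdsGT_zero (h.pos s hsR)] with ρ hρ hρs
  refine ⟨(h.mapsTo_inv_Ioo hρ).1, ?_⟩
  have := h.strictMonoOn_inv ⟨hρ.1.le, hρ.2⟩ (h.bijOn.mapsTo hsR') hρs.2
  rw [h.invOn.1 hsR'] at this
  exact this.trans (hs.trans_le (min_le_left _ _))

theorem continuousOn_inv (h : IsWarpingPair R L f f' F F') : ContinuousOn F (Ico 0 L) := by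
  intro ρ hρ
  rcases hρ.1.eq_or_lt with rfl | h0
  · have h1 : ContinuousWithinAt F (Ioi 0) 0 := by
      rw [ContinuousWithinAt, h.inv_zero]
      exact h.tendsto_inv.mono_right nhdsWithin_le_nhds
    exact (continuousWithinAt_Ioi_iff_Ici.1 h1).mono fun x hx => hx.1
  · exact (h.hasDerivAt_inv ρ ⟨h0, hρ.2⟩).continuousAt.continuousWithinAt

theorem deriv_mul_deriv_inv (h : IsWarpingPair R L f f' F F') {ρ : ℝ} (hρ : ρ ∈ Ioo 0 L) :
    f' (F ρ) * F' ρ = 1 := by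
  have h1 := (h.hasDerivAt _ (h.mapsTo_inv_Ioo hρ)).comp ρ (h.hasDerivAt_inv ρ hρ)
  refine h1.unique ((hasDerivAt_id ρ).congr_of_eventuallyEq ?_)
  filter_upwards [Ioo_mem_nhds hρ.1 hρ.2] with x hx
  exact h.invOn.2 ⟨hx.1.le, hx.2⟩

theorem deriv_inv_pos (h : IsWarpingPair R L f f' F F') {ρ : ℝ} (hρ : ρ ∈ Ioo 0 L) :
    0 < F' ρ := by
  refine lt_of_le_of_ne ?_ fun h0 => by simpa [← h0] using h.deriv_mul_deriv_inv hρ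
  have h1 : MonotoneOn F (Ioo 0 L) :=
    h.strictMonoOn_inv.monotoneOn.mono Ioo_subset_Ico_self
  have h2 := h1.derivWithin_nonneg (x := ρ)
  rwa [derivWithin_of_isOpen isOpen_Ioo hρ, (h.hasDerivAt_inv ρ hρ).deriv] at h2

theorem antitoneOn_deriv_inv (h : IsWarpingPair R L f f' F F') : AntitoneOn F' (Ioo 0 L) := by
  intro ρ hρ τ hτ hle
  have hF := h.strictMonoOn_inv.monotoneOn ⟨hρ.1.le, hρ.2⟩ ⟨hτ.1.le, hτ.2⟩ hle
  have hf : MonotoneOn f' (Ioo 0 R) := by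
    have h1 : MonotoneOn (deriv f) (Ioo 0 R) :=
      (h.convexOn.subset Ioo_subset_Ico_self (convex_Ioo 0 R)).monotoneOn_deriv
        fun x hx => (h.hasDerivAt x hx).differentiableAt
    exact h1.congr fun x hx => (h.hasDerivAt x hx).deriv
  have hle' := hf (h.mapsTo_inv_Ioo hρ) (h.mapsTo_inv_Ioo hτ) hF
  have h1 := h.deriv_mul_deriv_inv hρ
  have h2 := h.deriv_mul_deriv_inv hτ
  have h3 := h.deriv_inv_pos hρ
  have h4 := h.deriv_inv_pos hτ
  calc F' τ = (f' (F ρ) * F' ρ) * F' τ := by rw [h1, one_mul]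
    _ = f' (F ρ) * (F' τ * F' ρ) := by ring
    _ ≤ f' (F τ) * (F' τ * F' ρ) := by gcongr
    _ = (f' (F τ) * F' τ) * F' ρ := by ring
    _ = F' ρ := by rw [h2, one_mul]

variable {𝔉 : ℝ → ℝ}

theorem limit_nonneg (h : IsWarpingPair R L f f' F F') {σ l : ℝ} (hσ : 0 < σ)
    (hlim : Tendsto (fun ε => F' (σ * ε) / F' ε) (𝓝[>] 0) (𝓝 l)) : 0 ≤ l := by
  refine ge_of_tendsto hlim ?_
  have hL := eventually_mem_Ioo_nhdsGT_zero h.pos_right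
  filter_upwards [hL, (tendsto_const_mul_nhdsGT_zero hσ).eventually hL] with ε h1 h2
  exact (div_pos (h.deriv_inv_pos h2) (h.deriv_inv_pos h1)).le

theorem limit_one (h : IsWarpingPair R L f f' F F') {l : ℝ}
    (hlim : Tendsto (fun ε => F' (1 * ε) / F' ε) (𝓝[>] 0) (𝓝 l)) : l = 1 := by
  refine tendsto_nhds_unique hlim (tendsto_const_nhds.congr' ?_)
  filter_upwards [eventually_mem_Ioo_nhdsGT_zero h.pos_right] with ε hε
  rw [one_mul, div_self (h.deriv_inv_pos hε).ne']

theorem antitoneOn_limit (h : IsWarpingPair R L f f' F F')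
    (hlim : ∀ σ ≥ (1 : ℝ), Tendsto (fun ε => F' (σ * ε) / F' ε) (𝓝[>] 0) (𝓝 (𝔉 σ))) :
    AntitoneOn 𝔉 (Ici 1) := by
  intro σ hσ τ hτ hle
  refine le_of_tendsto_of_tendsto (hlim τ hτ) (hlim σ hσ) ?_
  have hL := eventually_mem_Ioo_nhdsGT_zero h.pos_right
  have hσ0 : 0 < σ := one_pos.trans_le hσ
  have hτ0 : 0 < τ := one_pos.trans_le hτ
  filter_upwards [hL, (tendsto_const_mul_nhdsGT_zero hσ0).eventually hL,
    (tendsto_const_mul_nhdsGT_zero hτ0).eventually hL] with ε h1 h2 h3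
  have := h.deriv_inv_pos h1
  have := h.antitoneOn_deriv_inv h2 h3 (mul_le_mul_of_nonneg_right hle h1.1.le)
  gcongr

theorem integrableOn_limit (h : IsWarpingPair R L f f' F F')
    (hlim : ∀ σ ≥ (1 : ℝ), Tendsto (fun ε => F' (σ * ε) / F' ε) (𝓝[>] 0) (𝓝 (𝔉 σ))) :
    IntegrableOn (fun θ => 𝔉 (1 / cos θ)) (Ioo (-(π / 2)) (π / 2)) := by
  have hanti : Antitone fun x => 𝔉 (max 1 x) := fun x y hxy =>
    h.antitoneOn_limit hlim (mem_Ici.2 (le_max_left _ _)) (mem_Ici.2 (le_max_left _ _))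
      (max_le_max_left 1 hxy)
  have hmeas : Measurable fun θ => 𝔉 (max 1 (1 / cos θ)) :=
    hanti.measurable.comp (measurable_const.div measurable_cos)
  have hbound : ∀ x, ‖𝔉 (max 1 x)‖ ≤ 1 := fun x => by
    have hx : (1 : ℝ) ≤ max 1 x := le_max_left _ _
    rw [Real.norm_of_nonneg (h.limit_nonneg (one_pos.trans_le hx) (hlim _ hx))]
    exact (h.antitoneOn_limit hlim self_mem_Ici hx hx).trans_eq (h.limit_one (hlim 1 le_rfl))
  have hint : IntegrableOn (fun θ => 𝔉 (max 1 (1 / cos θ))) (Ioo (-(π / 2)) (π / 2)) :=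
    Measure.integrableOn_of_bounded measure_Ioo_lt_top.ne hmeas.aestronglyMeasurable
      (Eventually.of_forall fun θ => hbound _)
  refine hint.congr_fun (fun θ hθ => ?_) measurableSet_Ioo
  dsimp only
  rw [max_eq_right ((one_le_div (cos_pos_of_mem_Ioo hθ)).2 (cos_le_one θ))]

end IsWarpingPair

/-- Integrating an eventual inequality `c F'(ε) ≤ F'(σ ε)` near `0`. -/
theorem eventually_mul_le_of_deriv {L σ c : ℝ} {F F' : ℝ → ℝ} (hL : 0 < L) (hσ : 0 < σ)
    (hcont : ContinuousOn F (Ico 0 L)) (h0 : F 0 = 0)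
    (hderiv : ∀ ρ ∈ Ioo 0 L, HasDerivAt F (F' ρ) ρ)
    (hle : ∀ᶠ ε in 𝓝[>] (0 : ℝ), c * F' ε ≤ F' (σ * ε)) :
    ∀ᶠ ε in 𝓝[>] (0 : ℝ), σ * c * F ε ≤ F (σ * ε) := by
  have hL' := eventually_mem_Ioo_nhdsGT_zero hL
  obtain ⟨δ, hδ, hsub⟩ := (nhdsGT_basis (0 : ℝ)).eventually_iff.1
    (hle.and (hL'.and ((tendsto_const_mul_nhdsGT_zero hσ).eventually hL')))
  have hmono : MonotoneOn (fun ε => F (σ * ε) - σ * c * F ε) (Ico 0 δ) := by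
    have hmem : ∀ ε ∈ Ico 0 δ, ε ∈ Ico 0 L ∧ σ * ε ∈ Ico 0 L := fun ε hε => by
      rcases hε.1.eq_or_lt with rfl | hpos
      · simpa using hL
      · obtain ⟨-, h1, h2⟩ := hsub ⟨hpos, hε.2⟩
        exact ⟨Ioo_subset_Ico_self h1, Ioo_subset_Ico_self h2⟩
    refine monotoneOn_of_hasDerivWithinAt_nonneg (convex_Ico 0 δ)
      (f' := fun ε => F' (σ * ε) * (σ * 1) - σ * c * F' ε) ?_ ?_ ?_
    · exact (hcont.comp (continuous_const_mul σ).continuousOn fun ε hε => (hmem ε hε).2).sub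
        (continuousOn_const.mul (hcont.mono fun ε hε => (hmem ε hε).1))
    · intro ε hε
      rw [interior_Ico] at hε
      obtain ⟨-, h1, h2⟩ := hsub hε
      exact (((hderiv _ h2).comp ε ((hasDerivAt_id ε).const_mul σ)).sub
        ((hderiv _ h1).const_mul (σ * c))).hasDerivWithinAt
    · intro ε hε
      rw [interior_Ico] at hε
      nlinarith [(hsub hε).1]
  filter_upwards [eventually_mem_Ioo_nhdsGT_zero hδ] with ε hε
  have := hmono ⟨le_rfl, hδ⟩ ⟨hε.1.le, hε.2⟩ hε.1.le
  simpa [h0] using this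

/-- If `G ≤ C H` near `0` then the growth factor of `H` under scaling by `σ > 1` is at most that
of `G`. -/
theorem le_of_eventually_scaling {σ a b C : ℝ} {G H : ℝ → ℝ} (hσ : 1 < σ) (ha : 0 < a)
    (hG : ∀ᶠ ε in 𝓝[>] (0 : ℝ), 0 < G ε)
    (hGa : ∀ᶠ ε in 𝓝[>] (0 : ℝ), G (σ * ε) ≤ a * G ε)
    (hHb : ∀ᶠ ε in 𝓝[>] (0 : ℝ), b * H ε ≤ H (σ * ε))
    (hC : 0 ≤ C) (hGH : ∀ᶠ ε in 𝓝[>] (0 : ℝ), G ε ≤ C * H ε) : b ≤ a := by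
  by_contra! hab
  have hb := ha.trans hab
  have hσ0 := one_pos.trans hσ
  obtain ⟨δ, hδ, hsub⟩ := (nhdsGT_basis (0 : ℝ)).eventually_iff.1
    (hG.and (hGa.and (hHb.and hGH)))
  obtain ⟨x, hx⟩ := exists_between hδ
  have hmem : ∀ n : ℕ, x / σ ^ n ∈ Ioo 0 δ := fun n =>
    ⟨div_pos hx.1 (pow_pos hσ0 n), (div_le_self hx.1.le (one_le_pow₀ hσ.le)).trans_lt hx.2⟩
  have hstep : ∀ n : ℕ, σ * (x / σ ^ (n + 1)) = x / σ ^ n := fun n => by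
    field_simp
    ring
  have h1 : ∀ n : ℕ, G x ≤ a ^ n * G (x / σ ^ n) := fun n => by
    induction n with
    | zero => simp
    | succ n ih =>
      have := (hsub (hmem (n + 1))).2.1
      rw [hstep] at this
      calc G x ≤ a ^ n * G (x / σ ^ n) := ih
        _ ≤ a ^ n * (a * G (x / σ ^ (n + 1))) := by gcongr
        _ = a ^ (n + 1) * G (x / σ ^ (n + 1)) := by ring
  have h2 : ∀ n : ℕ, b ^ n * H (x / σ ^ n) ≤ H x := fun n => by
    induction n with
    | zero => simp
    | succ n ih =>
      have := (hsub (hmem (n + 1))).2.2.1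
      rw [hstep] at this
      calc b ^ (n + 1) * H (x / σ ^ (n + 1)) = b ^ n * (b * H (x / σ ^ (n + 1))) := by ring
        _ ≤ b ^ n * H (x / σ ^ n) := by gcongr
        _ ≤ H x := ih
  have h3 : ∀ n : ℕ, G x ≤ (a / b) ^ n * (C * H x) := fun n =>
    calc G x ≤ a ^ n * G (x / σ ^ n) := h1 n
      _ ≤ a ^ n * (C * H (x / σ ^ n)) := by gcongr; exact (hsub (hmem n)).2.2.2
      _ = (a / b) ^ n * (C * (b ^ n * H (x / σ ^ n))) := by
        rw [div_pow]; field_simp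
      _ ≤ (a / b) ^ n * (C * H x) := by gcongr; exact h2 n
  have hlim : Tendsto (fun n : ℕ => (a / b) ^ n * (C * H x)) atTop (𝓝 0) := by
    simpa using (tendsto_pow_atTop_nhds_zero_of_lt_one (div_pos ha hb).le
      ((div_lt_one hb).2 hab)).mul_const (C * H x)
  exact absurd (ge_of_tendsto' hlim h3) (not_le.2 (hsub hx).1)

namespace IsWarpingPair

variable {R L Lt : ℝ} {f f' F F' ft ft' Ft Ft' : ℝ → ℝ}

theorem exists_inv_le_mul_inv (h : IsWarpingPair R L f f' F F')
    (ht : IsWarpingPair R Lt ft ft' Ft Ft') (hO : f =O[𝓝[>] 0] ft) :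
    ∃ C ≥ 0, ∀ᶠ ρ in 𝓝[>] (0 : ℝ), Ft ρ ≤ C * F ρ := by
  obtain ⟨C, hC⟩ := hO.bound
  set D := max C 1
  have hD1 : 1 ≤ D := le_max_right _ _
  have hD0 : 0 < D := one_pos.trans_le hD1
  refine ⟨D, hD0.le, ?_⟩
  filter_upwards [ht.tendsto_inv.eventually hC, eventually_mem_Ioo_nhdsGT_zero h.pos_right,
    eventually_mem_Ioo_nhdsGT_zero ht.pos_right] with ρ hρ hL hLt
  have hr := ht.mapsTo_inv_Ioo hLt
  set r := Ft ρ
  have hftr : ft r = ρ := ht.invOn.2 ⟨hLt.1.le, hLt.2⟩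
  rw [Real.norm_of_nonneg (h.pos r hr).le, hftr, Real.norm_of_nonneg hLt.1.le] at hρ
  have hDinv : D⁻¹ ∈ Icc (0 : ℝ) 1 := ⟨(inv_pos.2 hD0).le, inv_le_one_of_one_le₀ hD1⟩
  have hscale : D⁻¹ * r ∈ Ico 0 R :=
    ⟨mul_nonneg hDinv.1 hr.1.le, (mul_le_of_le_one_left hr.1.le hDinv.2).trans_lt hr.2⟩
  have h1 : f (D⁻¹ * r) ≤ ρ :=
    calc f (D⁻¹ * r) ≤ D⁻¹ * f r :=
          h.convexOn.map_mul_le_mul_map h.pos_left h.map_zero hDinv ⟨hr.1.le, hr.2⟩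
      _ ≤ D⁻¹ * (D * ρ) := by
        have := hDinv.1
        have := hLt.1
        gcongr
        exact hρ.trans (by gcongr; exact le_max_left _ _)
      _ = ρ := inv_mul_cancel_left₀ hD0.ne' ρ
  have h2 := h.strictMonoOn_inv.monotoneOn (h.bijOn.mapsTo hscale) ⟨hL.1.le, hL.2⟩ h1
  rw [h.invOn.1 hscale] at h2
  exact (inv_mul_le_iff₀ hD0).1 h2

theorem limit_le_limit (h : IsWarpingPair R L f f' F F')
    (ht : IsWarpingPair R Lt ft ft' Ft Ft') (hO : f =O[𝓝[>] 0] ft) {σ l lt : ℝ} (hσ : 1 ≤ σ)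
    (hlim : Tendsto (fun ε => F' (σ * ε) / F' ε) (𝓝[>] 0) (𝓝 l))
    (htlim : Tendsto (fun ε => Ft' (σ * ε) / Ft' ε) (𝓝[>] 0) (𝓝 lt)) : l ≤ lt := by
  rcases hσ.eq_or_lt with rfl | hσ1
  · rw [h.limit_one hlim, ht.limit_one htlim]
  have hσ0 := one_pos.trans hσ1
  by_contra! hlt
  obtain ⟨q, hq, hql⟩ := exists_between hlt
  obtain ⟨p, hp, hpq⟩ := exists_between hq
  have hp0 : 0 < p := (ht.limit_nonneg hσ0 htlim).trans_lt hp
  have hF : ∀ᶠ ε in 𝓝[>] (0 : ℝ), σ * q * F ε ≤ F (σ * ε) := by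
    refine eventually_mul_le_of_deriv h.pos_right hσ0 h.continuousOn_inv h.inv_zero
      h.hasDerivAt_inv ?_
    filter_upwards [hlim.eventually_const_lt hql,
      eventually_mem_Ioo_nhdsGT_zero h.pos_right] with ε hε hL
    exact ((lt_div_iff₀ (h.deriv_inv_pos hL)).1 hε).le
  have hFt : ∀ᶠ ε in 𝓝[>] (0 : ℝ), Ft (σ * ε) ≤ σ * p * Ft ε := by
    have := eventually_mul_le_of_deriv (c := p) (F := -Ft) (F' := -Ft') ht.pos_right hσ0
      ht.continuousOn_inv.neg (by simp [ht.inv_zero]) (fun ρ hρ => (ht.hasDerivAt_inv ρ hρ).neg) ?_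
    · filter_upwards [this] with ε hε
      simpa using hε
    · filter_upwards [htlim.eventually_lt_const hp,
        eventually_mem_Ioo_nhdsGT_zero ht.pos_right] with ε hε hL
      simpa using ((div_lt_iff₀ (ht.deriv_inv_pos hL)).1 hε).le
  obtain ⟨C, hC, hFC⟩ := h.exists_inv_le_mul_inv ht hO
  have hpos : ∀ᶠ ε in 𝓝[>] (0 : ℝ), 0 < Ft ε :=
    (eventually_mem_Ioo_nhdsGT_zero ht.pos_right).mono fun ε hε => (ht.mapsTo_inv_Ioo hε).1
  have := le_of_eventually_scaling hσ1 (mul_pos hσ0 hp0) hpos hFt hF hC hFC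
  exact absurd (le_of_mul_le_mul_left this hσ0) (not_le.2 hpq)

end IsWarpingPair

/-- Monotonicity of `𝔉` and `C_f` in the warping function: if `f, f̃` are C¹, convex,
vanish at `0`, positive on `(0,R)`, their limits `𝔉, 𝔉̃` exist, and `f = O(f̃)` near
zero, then `𝔉 ≤ 𝔉̃` on `[1,∞)` and `C_f ≤ C_{f̃}`. -/
theorem frakF_monotone
    (R L Lt : ℝ) (hR : 0 < R) (hL : 0 < L) (hLt : 0 < Lt)
    (f f' F F' 𝔉 ft ft' Ft Ft' 𝔉t : ℝ → ℝ)
    (hcont : ContinuousOn f (Set.Ico 0 R))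
    (hderiv : ∀ r ∈ Set.Ioo 0 R, HasDerivAt f (f' r) r)
    (hf'cont : ContinuousOn f' (Set.Ioo 0 R))
    (hconv : ConvexOn ℝ (Set.Ico 0 R) f)
    (hf0 : f 0 = 0)
    (hpos : ∀ r ∈ Set.Ioo 0 R, 0 < f r)
    (htcont : ContinuousOn ft (Set.Ico 0 R))
    (htderiv : ∀ r ∈ Set.Ioo 0 R, HasDerivAt ft (ft' r) r)
    (hft'cont : ContinuousOn ft' (Set.Ioo 0 R))
    (htconv : ConvexOn ℝ (Set.Ico 0 R) ft)
    (hft0 : ft 0 = 0)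
    (htpos : ∀ r ∈ Set.Ioo 0 R, 0 < ft r)
    (hbij : Set.BijOn f (Set.Ico 0 R) (Set.Ico 0 L))
    (hinv : Set.InvOn F f (Set.Ico 0 R) (Set.Ico 0 L))
    (hFderiv : ∀ ρ ∈ Set.Ioo 0 L, HasDerivAt F (F' ρ) ρ)
    (htbij : Set.BijOn ft (Set.Ico 0 R) (Set.Ico 0 Lt))
    (htinv : Set.InvOn Ft ft (Set.Ico 0 R) (Set.Ico 0 Lt))
    (hFtderiv : ∀ ρ ∈ Set.Ioo 0 Lt, HasDerivAt Ft (Ft' ρ) ρ)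
    (hlim : ∀ σ ≥ (1 : ℝ),
      Filter.Tendsto (fun ε => F' (σ * ε) / F' ε) (nhdsWithin 0 (Set.Ioi 0)) (nhds (𝔉 σ)))
    (htlim : ∀ σ ≥ (1 : ℝ),
      Filter.Tendsto (fun ε => Ft' (σ * ε) / Ft' ε) (nhdsWithin 0 (Set.Ioi 0)) (nhds (𝔉t σ)))
    (hO : f =O[nhdsWithin 0 (Set.Ioi 0)] ft) :
    (∀ σ ≥ (1 : ℝ), 𝔉 σ ≤ 𝔉t σ) ∧
      (∫ θ in (-(π / 2))..(π / 2), 𝔉 (1 / Real.cos θ)) ≤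
        ∫ θ in (-(π / 2))..(π / 2), 𝔉t (1 / Real.cos θ) := by
  have h : IsWarpingPair R L f f' F F' :=
    ⟨hR, hL, hderiv, hconv, hf0, hpos, hFderiv, hbij, hinv⟩
  have ht : IsWarpingPair R Lt ft ft' Ft Ft' :=
    ⟨hR, hLt, htderiv, htconv, hft0, htpos, hFtderiv, htbij, htinv⟩
  have hle : ∀ σ ≥ (1 : ℝ), 𝔉 σ ≤ 𝔉t σ := fun σ hσ =>
    h.limit_le_limit ht hO hσ (hlim σ hσ) (htlim σ hσ)
  refine ⟨hle, ?_⟩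
  have hab : -(π / 2) ≤ π / 2 := by linarith [pi_pos]
  simp only [intervalIntegral.integral_of_le hab, integral_Ioc_eq_integral_Ioo]
  refine setIntegral_mono_on (h.integrableOn_limit hlim) (ht.integrableOn_limit htlim)
    measurableSet_Ioo fun θ hθ => hle _ ?_
  exact (one_le_div (cos_pos_of_mem_Ioo hθ)).2 (cos_le_one θ)
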